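/- Let T be a triangulated category, a, b1, b2 objects, and h1 : b1 → Σa, h2 : b2 → Σa nonzero morphisms such that h1 = h2 ∘ β for some β : b1 → b2. Let f be the cocone of h2, i.e. there is a distinguished triangle a → f → b2 --h2--> Σa. Then any distinguished triangle a → e → b1 ⊕ b2 --(h1,h2)--> Σa has e ≅ b1 ⊕ f. More precisely, the triangle (a, e, b1⊕b2, (h1,h2)) is isomorphic to the triangle a → b1 ⊕ f → b1 ⊕ b2 --(0,h2)--> Σa. -/

import Mathlib

open CategoryTheory CategoryTheory.Limits CategoryTheory.Pretriangulated

section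

variable {C : Type*} [Category C]

/-- A morphism is invertible as soon as both composites with some morphism in the opposite
direction are. -/
lemma isIso_of_isIso_comp_both {X Y : C} (g : X ⟶ Y) (g' : Y ⟶ X)
    (hl : IsIso (g ≫ g')) (hr : IsIso (g' ≫ g)) : IsIso g := by
  have : Mono g := mono_of_mono g g'
  have : IsSplitEpi g := ⟨⟨⟨inv (g' ≫ g) ≫ g', by simp⟩⟩⟩
  exact isIso_of_mono_of_isSplitEpi g

variable [Preadditive C] [HasZeroObject C] [HasShift C ℤ]
  [∀ n : ℤ, (shiftFunctor C n).Additive] [Pretriangulated C]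

/-- An endomorphism of the middle object of a distinguished triangle that is compatible with the
identities of the outer objects is invertible. -/
lemma isIso_of_distTriang_of_comp_eq {X Y Z : C} {i : X ⟶ Y} {j : Y ⟶ Z} {d : Z ⟶ X⟦(1 : ℤ)⟧}
    (h : Triangle.mk i j d ∈ distTriang C) (t : Y ⟶ Y) (hi : i ≫ t = i) (hj : t ≫ j = j) :
    IsIso t := by
  let φ : Triangle.mk i j d ⟶ Triangle.mk i j d :=
    Triangle.homMk _ _ (𝟙 X) t (𝟙 Z)
      (hi.trans (Category.id_comp i).symm) ((Category.comp_id j).trans hj.symm)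
      (by
        change d ≫ (𝟙 X)⟦(1 : ℤ)⟧' = 𝟙 Z ≫ d
        rw [CategoryTheory.Functor.map_id, Category.comp_id, Category.id_comp])
  exact isIso₂_of_isIso₁₃ φ h h (inferInstanceAs (IsIso (𝟙 X))) (inferInstanceAs (IsIso (𝟙 Z)))

/-- A morphism between the third objects of two distinguished triangles with the same first object
that is compatible with the connecting morphisms lifts to the middle objects. -/
lemma exists_middle_hom_of_distTriang {X Y Z Y' Z' : C} {i : X ⟶ Y} {j : Y ⟶ Z}
    {d : Z ⟶ X⟦(1 : ℤ)⟧} {i' : X ⟶ Y'} {j' : Y' ⟶ Z'} {d' : Z' ⟶ X⟦(1 : ℤ)⟧}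
    (h : Triangle.mk i j d ∈ distTriang C) (h' : Triangle.mk i' j' d' ∈ distTriang C)
    (g : Z ⟶ Z') (hg : g ≫ d' = d) :
    ∃ t : Y ⟶ Y', i ≫ t = i' ∧ j ≫ g = t ≫ j' := by
  obtain ⟨t, ht₁, ht₂⟩ := complete_distinguished_triangle_morphism₂ _ _ h h' (𝟙 X) g (by
    change d ≫ (𝟙 X)⟦(1 : ℤ)⟧' = g ≫ d'
    rw [CategoryTheory.Functor.map_id, Category.comp_id, hg])
  exact ⟨t, ht₁.trans (Category.id_comp i'), ht₂⟩

end

/-- If `h1 : b1 ⟶ Σa` factors as `h1 = β ≫ h2` through `h2 : b2 ⟶ Σa`, and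
`f` is the cocone of `h2` (via the triangle `a ⟶ f ⟶ b2 ⟶ Σa`), then any
distinguished triangle `a ⟶ e ⟶ b1 ⊞ b2 ⟶ Σa` with third map `(h1, h2)` is
isomorphic to `a ⟶ b1 ⊞ f ⟶ b1 ⊞ b2 ⟶ Σa` with third map `(0, h2)`;
in particular `e ≅ b1 ⊞ f`. -/
theorem stmt_3 {C : Type*} [Category C] [Preadditive C] [HasZeroObject C]
    [HasShift C ℤ] [∀ n : ℤ, (shiftFunctor C n).Additive] [Pretriangulated C]
    [HasBinaryBiproducts C]
    {a b₁ b₂ e f : C} (h₁ : b₁ ⟶ a⟦(1 : ℤ)⟧) (h₂ : b₂ ⟶ a⟦(1 : ℤ)⟧)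
    (hh₁ : h₁ ≠ 0) (hh₂ : h₂ ≠ 0) (β : b₁ ⟶ b₂) (hfac : h₁ = β ≫ h₂)
    (u : a ⟶ f) (v : f ⟶ b₂)
    (hf : Triangle.mk u v h₂ ∈ distTriang C)
    (p : a ⟶ e) (q : e ⟶ b₁ ⊞ b₂)
    (hT : Triangle.mk p q (biprod.desc h₁ h₂) ∈ distTriang C) :
    Nonempty (Triangle.mk p q (biprod.desc h₁ h₂) ≅
      Triangle.mk (biprod.lift 0 u) (biprod.map (𝟙 b₁) v) (biprod.desc 0 h₂)) ∧
    Nonempty (e ≅ b₁ ⊞ f) := by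
  obtain ⟨k, hk₁, hk₂⟩ := exists_middle_hom_of_distTriang hT hf (biprod.desc β (𝟙 b₂))
    (by ext <;> simp [hfac])
  obtain ⟨m, hm₁, hm₂⟩ := exists_middle_hom_of_distTriang hf hT (biprod.inr : b₂ ⟶ b₁ ⊞ b₂)
    (by simp)
  obtain ⟨s, hs⟩ : ∃ s : b₁ ⟶ e, biprod.lift (𝟙 b₁) (-β) = s ≫ q :=
    Triangle.coyoneda_exact₃ _ hT (biprod.lift (𝟙 b₁) (-β)) (by
      change biprod.lift (𝟙 b₁) (-β) ≫ biprod.desc h₁ h₂ = 0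
      simp [biprod.lift_desc, hfac])
  have hpq : p ≫ q = 0 := comp_distTriang_mor_zero₁₂ _ hT
  obtain ⟨w, hw⟩ : ∃ w : b₁ ⟶ a, s ≫ k = w ≫ u :=
    Triangle.coyoneda_exact₂ _ hf (s ≫ k) (by
      change (s ≫ k) ≫ v = 0
      rw [Category.assoc, ← hk₂, ← Category.assoc, ← hs]
      simp [biprod.lift_desc])
  obtain ⟨r, hrq, hrk⟩ : ∃ r : b₁ ⟶ e, r ≫ q = biprod.lift (𝟙 b₁) (-β) ∧ r ≫ k = 0 :=
    ⟨s - w ≫ p, by simp [Preadditive.sub_comp, hpq, hs], by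
      simp [Preadditive.sub_comp, hk₁, hw]⟩
  have hθ : IsIso (m ≫ k) := isIso_of_distTriang_of_comp_eq hf _
    (by rw [← Category.assoc, hm₁, hk₁])
    (by rw [Category.assoc, ← hk₂, ← Category.assoc, ← hm₂]; simp)
  let φ : e ⟶ b₁ ⊞ f := biprod.lift (q ≫ biprod.fst) k
  let ψ : b₁ ⊞ f ⟶ e := biprod.desc r m
  have hpφ : p ≫ φ = biprod.lift 0 u := by
    ext <;> simp [φ, hk₁, reassoc_of% hpq]
  have hφv : φ ≫ biprod.map (𝟙 b₁) v = q ≫ biprod.lift biprod.fst (biprod.desc β (𝟙 b₂)) := by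
    ext <;> simp [φ, hk₂]
  have hψφ : ψ ≫ φ = biprod.map (𝟙 b₁) (m ≫ k) := by
    ext <;> simp [φ, ψ, hrk, reassoc_of% hrq, ← reassoc_of% hm₂]
  have hφψ : IsIso (φ ≫ ψ) := isIso_of_distTriang_of_comp_eq hT _
    (by rw [← Category.assoc, hpφ]; simp [ψ, biprod.lift_desc, hm₁])
    (by
      simp only [φ, ψ, biprod.lift_desc, Preadditive.add_comp, Category.assoc, hrq, ← hm₂,
        ← reassoc_of% hk₂]
      ext <;> simp [biprod.desc_eq])
  have hφ : IsIso φ := isIso_of_isIso_comp_both φ ψ hφψ (by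
    rw [hψφ]
    exact (biprod.mapIso (Iso.refl b₁) (asIso (m ≫ k))).isIso_hom)
  let σ : b₁ ⊞ b₂ ≅ b₁ ⊞ b₂ :=
    { hom := biprod.lift biprod.fst (biprod.desc β (𝟙 b₂))
      inv := biprod.lift biprod.fst (biprod.desc (-β) (𝟙 b₂))
      hom_inv_id := by ext <;> simp [biprod.desc_eq]
      inv_hom_id := by ext <;> simp [biprod.desc_eq] }
  let Φ : e ≅ b₁ ⊞ f := asIso φ
  refine ⟨⟨Triangle.isoMk _ _ (Iso.refl a) Φ σ ?_ ?_ ?_⟩, ⟨Φ⟩⟩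
  · exact hpφ.trans (Category.id_comp _).symm
  · exact hφv.symm
  · change biprod.desc h₁ h₂ ≫ (𝟙 a)⟦(1 : ℤ)⟧' =
      biprod.lift biprod.fst (biprod.desc β (𝟙 b₂)) ≫ biprod.desc 0 h₂
    ext <;> simp [biprod.lift_desc, hfac]
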